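/- Let n : ℕ, S : (Fin n → Bool) → Bool be a set of states over the unprimed variables, and R : (Fin n → Bool) → (Fin n → Bool) → Bool a transition relation. Encode assignments over the interleaved variables as a : (Fin n ⊕ Fin n) → Bool, with Sum.inl the unprimed and Sum.inr the primed copies, and define χ′ a = S (a ∘ Sum.inr) && R (a ∘ Sum.inl) (a ∘ Sum.inr) (i.e., S with the substitution [x/x′] applied, conjoined with R). Let E′ be obtained from χ′ by existentially quantifying, one at a time, every primed variable Sum.inr i for i : Fin n (via exQ, folded over any duplicate-free enumeration of the primed indices). Then for every s : Fin n → Bool, E′ (Sum.elim s s) = true if and only if there exists t : Fin n → Bool with R s t = true and S t = true. -/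

import Mathlib

def exQ {ι : Type*} [DecidableEq ι] (i : ι) (f : (ι → Bool) → Bool) : (ι → Bool) → Bool :=
  fun a => f (Function.update a i true) || f (Function.update a i false)

theorem foldr_exQ_iff {ι κ : Type*} [DecidableEq ι] (e : κ → ι) (f : (ι → Bool) → Bool)
    (l : List κ) : ∀ a : ι → Bool,
    List.foldr (fun i g => exQ (e i) g) f l a = true ↔
      ∃ b : ι → Bool, (∀ j, (∀ i ∈ l, j ≠ e i) → b j = a j) ∧ f b = true := by
  induction l with
  | nil =>
    intro a
    constructor
    · intro h
      exact ⟨a, fun _ _ => rfl, h⟩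
    · rintro ⟨b, hb, h⟩
      have : b = a := funext fun j => hb j (by simp)
      simpa [this] using h
  | cons i l ih =>
    intro a
    have key : List.foldr (fun i g => exQ (e i) g) f (i :: l) a = true ↔
        ∃ v : Bool, List.foldr (fun i g => exQ (e i) g) f l (Function.update a (e i) v) = true := by
      simp [exQ, or_comm]
    rw [key]
    constructor
    · rintro ⟨v, hv⟩
      obtain ⟨b, hb, h⟩ := (ih _).1 hv
      refine ⟨b, fun j hj => ?_, h⟩
      rw [hb j (fun k hk => hj k (List.mem_cons_of_mem _ hk)),
        Function.update_of_ne (hj i List.mem_cons_self)]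
    · rintro ⟨b, hb, h⟩
      refine ⟨b (e i), (ih _).2 ⟨b, fun j hj => ?_, h⟩⟩
      by_cases hji : j = e i
      · subst hji
        simp
      · rw [Function.update_of_ne hji]
        apply hb
        intro k hk
        rcases List.mem_cons.1 hk with rfl | hk
        · exact hji
        · exact hj k hk

theorem relprev_correct (n : ℕ) (S : (Fin n → Bool) → Bool)
    (R : (Fin n → Bool) → (Fin n → Bool) → Bool)
    (χ' : ((Fin n ⊕ Fin n) → Bool) → Bool)
    (hχ' : ∀ a : (Fin n ⊕ Fin n) → Bool,
      χ' a = (S (a ∘ Sum.inr) && R (a ∘ Sum.inl) (a ∘ Sum.inr)))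
    (l : List (Fin n)) (hl : l.Nodup) (hcomplete : ∀ i : Fin n, i ∈ l)
    (E' : ((Fin n ⊕ Fin n) → Bool) → Bool)
    (hE' : E' = List.foldr (fun i g => exQ (Sum.inr i) g) χ' l)
    (s : Fin n → Bool) :
    E' (Sum.elim s s) = true ↔ ∃ t : Fin n → Bool, R s t = true ∧ S t = true := by
  subst hE'
  rw [foldr_exQ_iff]
  constructor
  · rintro ⟨b, hb, h⟩
    rw [hχ', Bool.and_eq_true] at h
    have hs : b ∘ Sum.inl = s := funext fun j => hb (Sum.inl j) (by simp)
    rw [hs] at h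
    exact ⟨b ∘ Sum.inr, h.2, h.1⟩
  · rintro ⟨t, hR, hS⟩
    refine ⟨Sum.elim s t, ?_, ?_⟩
    · rintro (j | j) hj
      · rfl
      · exact absurd rfl (hj j (hcomplete j))
    · rw [hχ']
      simp [hR, hS]
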